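/- arXiv:2304.13239 — 4 statements merged into one kernel-verified Lean document; each statement's English description precedes it below -/
import Mathlib

section
/- Fix α > 0. For each k ≥ 1 the limit λ_k := lim_{N→∞} λ_k(Q_N) exists (the sequence N ↦ λ_k(Q_N), N ≥ k, is monotone nonincreasing and bounded below). Moreover, the limits are strictly increasing, λ_k < λ_{k+1} for all k ≥ 1, and satisfy the growth bound λ_k ≥ α k² for all k ≥ 2. -/
open Filter

/-- The `N × N` truncation `Q_N = B_α^𝒪(N)` of the odd Jacobi operator: symmetric
tridiagonal, diagonal entries `α k² + 2` (`k = 1, …, N`), off-diagonal entries `-1`. -/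
def Qmat (α : ℝ) (N : ℕ) : Matrix (Fin N) (Fin N) ℝ := fun i j =>
  if (i : ℕ) = (j : ℕ) then α * ((i : ℕ) + 1 : ℝ) ^ 2 + 2
  else if (i : ℕ) + 1 = (j : ℕ) ∨ (j : ℕ) + 1 = (i : ℕ) then -1 else 0

/-- `μ` lists the eigenvalues of the real symmetric matrix `M` in nondecreasing order with
multiplicity. -/
def IsEigSeq {N : ℕ} (M : Matrix (Fin N) (Fin N) ℝ) (μ : Fin N → ℝ) : Prop :=
  Monotone μ ∧ ∃ v : Fin N → (Fin N → ℝ),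
    (∀ i j, (∑ t, v i t * v j t) = if i = j then (1 : ℝ) else 0) ∧
    ∀ i, M.mulVec (v i) = μ i • v i

/-- `λ_k(Q_N)` with `1`-based index `k` (junk value `0` when `k > N` or `k = 0`). -/
noncomputable def eigAt (μ : (N : ℕ) → Fin N → ℝ) (k N : ℕ) : ℝ :=
  if h : k - 1 < N then μ N ⟨k - 1, h⟩ else 0

open Matrix Finset

/-- In an orthonormal eigenbasis, the squared norm and the quadratic form are diagonal. -/
theorem IsEigSeq.exists_diagonalization {N : ℕ} {A : Matrix (Fin N) (Fin N) ℝ} {μ : Fin N → ℝ}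
    (h : IsEigSeq A μ) : ∃ V : Matrix (Fin N) (Fin N) ℝ,
      (∀ x, x ⬝ᵥ x = ∑ j, (V *ᵥ x) j ^ 2) ∧
      ∀ x, x ⬝ᵥ (A *ᵥ x) = ∑ j, μ j * (V *ᵥ x) j ^ 2 := by
  obtain ⟨-, v, hv, hA⟩ := h
  have h1 : Matrix.of v * (Matrix.of v)ᵀ = 1 := by
    ext i j
    simp [Matrix.mul_apply, Matrix.one_apply, hv]
  have h2 : (Matrix.of v)ᵀ * Matrix.of v = 1 := mul_eq_one_comm.mp h1
  have h3 : A * (Matrix.of v)ᵀ = (Matrix.of v)ᵀ * Matrix.diagonal μ := by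
    ext i j
    rw [Matrix.mul_diagonal]
    have := congrFun (hA j) i
    simpa [Matrix.mul_apply, Matrix.mulVec, dotProduct, mul_comm] using this
  have h4 : A = (Matrix.of v)ᵀ * Matrix.diagonal μ * Matrix.of v := by
    rw [← h3, Matrix.mul_assoc, h2, Matrix.mul_one]
  refine ⟨Matrix.of v, fun x => ?_, fun x => ?_⟩
  · calc x ⬝ᵥ x = x ⬝ᵥ (((Matrix.of v)ᵀ * Matrix.of v) *ᵥ x) := by rw [h2, Matrix.one_mulVec]
      _ = (Matrix.of v *ᵥ x) ⬝ᵥ (Matrix.of v *ᵥ x) := by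
        rw [← Matrix.mulVec_mulVec, Matrix.dotProduct_mulVec, Matrix.vecMul_transpose]
      _ = _ := by simp [dotProduct, sq]
  · calc x ⬝ᵥ (A *ᵥ x) =
          x ⬝ᵥ (((Matrix.of v)ᵀ * Matrix.diagonal μ * Matrix.of v) *ᵥ x) := by rw [← h4]
      _ = (Matrix.of v *ᵥ x) ⬝ᵥ (Matrix.diagonal μ *ᵥ (Matrix.of v *ᵥ x)) := by
        rw [← Matrix.mulVec_mulVec, ← Matrix.mulVec_mulVec, Matrix.dotProduct_mulVec,
          Matrix.vecMul_transpose]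
      _ = _ := by
        simp only [dotProduct, Matrix.mulVec_diagonal]
        exact Finset.sum_congr rfl fun j _ => by ring

/-- Comparison of eigenvalues through an isometric embedding that does not increase the quadratic
form (a consequence of the Courant–Fischer principle). -/
theorem IsEigSeq.le_of_form_le {N N' : ℕ} {A : Matrix (Fin N) (Fin N) ℝ}
    {B : Matrix (Fin N') (Fin N') ℝ} {μ : Fin N → ℝ} {ν : Fin N' → ℝ}
    (hA : IsEigSeq A μ) (hB : IsEigSeq B ν) (L : (Fin N → ℝ) →ₗ[ℝ] (Fin N' → ℝ))
    (hL : ∀ x, L x ⬝ᵥ L x = x ⬝ᵥ x)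
    (hq : ∀ x, L x ⬝ᵥ (B *ᵥ L x) ≤ x ⬝ᵥ (A *ᵥ x))
    (k : Fin N) (k' : Fin N') (hk : (k : ℕ) = k') : ν k' ≤ μ k := by
  obtain ⟨V, hV, hVA⟩ := hA.exists_diagonalization
  obtain ⟨W, hW, hWB⟩ := hB.exists_diagonalization
  let F : (Fin N → ℝ) →ₗ[ℝ] ({j : Fin N // j ≠ k} → ℝ) := LinearMap.pi fun j =>
    if h : (j : Fin N) < k then
      LinearMap.proj (⟨(j : Fin N), by have := k'.2; have : (j : Fin N).1 < k.1 := h; omega⟩ : Fin N')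
        ∘ₗ W.mulVecLin ∘ₗ L
    else LinearMap.proj (j : Fin N) ∘ₗ V.mulVecLin
  have hker : LinearMap.ker F ≠ ⊥ := by
    apply LinearMap.ker_ne_bot_of_finrank_lt
    have : 0 < N := k.pos
    simp [Fintype.card_subtype_compl]
    omega
  obtain ⟨x, hx, hx0⟩ := (Submodule.ne_bot_iff _).mp hker
  have hFx : ∀ j, F x j = 0 := fun j => congrFun (LinearMap.mem_ker.mp hx) j
  have hup : x ⬝ᵥ (A *ᵥ x) ≤ μ k * (x ⬝ᵥ x) := by
    rw [hVA, hV, Finset.mul_sum]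
    refine Finset.sum_le_sum fun j _ => ?_
    rcases le_or_gt j k with hjk | hjk
    · exact mul_le_mul_of_nonneg_right (hA.1 hjk) (sq_nonneg _)
    · have := hFx ⟨j, hjk.ne'⟩
      have : (V *ᵥ x) j = 0 := by simpa [F, hjk.not_gt] using this
      simp [this]
  have hlow : ν k' * (L x ⬝ᵥ L x) ≤ L x ⬝ᵥ (B *ᵥ L x) := by
    rw [hWB, hW, Finset.mul_sum]
    refine Finset.sum_le_sum fun j _ => ?_
    rcases le_or_gt k' j with hjk | hjk
    · exact mul_le_mul_of_nonneg_right (hB.1 hjk) (sq_nonneg _)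
    · have hj : (j : ℕ) < k := by rw [hk]; exact hjk
      have hj' : (⟨j, hj.trans k.2⟩ : Fin N) < k := hj
      have := hFx ⟨⟨j, hj.trans k.2⟩, hj'.ne⟩
      have : (W *ᵥ L x) j = 0 := by
        rw [LinearMap.pi_apply, dif_pos hj'] at this
        exact this
      simp [this]
  have hpos : 0 < x ⬝ᵥ x := by
    refine lt_of_le_of_ne (Finset.sum_nonneg fun i _ => mul_self_nonneg _) fun h => hx0 ?_
    exact dotProduct_self_eq_zero.mp h.symm
  rw [hL] at hlow
  exact le_of_mul_le_mul_right (hlow.trans ((hq x).trans hup)) hpos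

/-- A vector placed at the positions `1, …, N` of a sequence that vanishes elsewhere. -/
def shiftExtend {N : ℕ} (x : Fin N → ℝ) : ℕ → ℝ
  | 0 => 0
  | n + 1 => if h : n < N then x ⟨n, h⟩ else 0

theorem shiftExtend_succ {N : ℕ} (x : Fin N → ℝ) (i : Fin N) :
    shiftExtend x (i + 1) = x i := by
  simp [shiftExtend]

theorem Qmat_mulVec_apply (α : ℝ) {N : ℕ} (x : Fin N → ℝ) (i : Fin N) :
    (Qmat α N *ᵥ x) i = (α * ((i : ℕ) + 1 : ℝ) ^ 2 + 2) * shiftExtend x (i + 1)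
      - shiftExtend x i - shiftExtend x (i + 2) := by
  have key : ∀ j : Fin N, Qmat α N i j * x j =
      (if i = j then (α * ((i : ℕ) + 1 : ℝ) ^ 2 + 2) * x j else 0)
        - (if (j : ℕ) + 1 = i then x j else 0) - (if (i : ℕ) + 1 = j then x j else 0) := by
    intro j
    simp only [Qmat, Fin.ext_iff]
    split_ifs <;> first | omega | ring
  simp only [Matrix.mulVec, dotProduct, key, Finset.sum_sub_distrib, Finset.sum_ite_eq,
    Finset.mem_univ, if_true, shiftExtend_succ]
  congr 1
  · congr 1
    obtain ⟨i, hi⟩ := i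
    cases i with
    | zero => simp [shiftExtend]
    | succ n =>
      have hn : n < N := by omega
      rw [Finset.sum_eq_single (⟨n, hn⟩ : Fin N)]
      · simp [shiftExtend, hn]
      · intro b _ hb
        have : (b : ℕ) ≠ n := fun h => hb (Fin.ext h)
        simp [this]
      · simp
  · by_cases h : (i : ℕ) + 1 < N
    · rw [Finset.sum_eq_single (⟨i + 1, h⟩ : Fin N)]
      · simp [shiftExtend, h]
      · intro b _ hb
        have : (i : ℕ) + 1 ≠ b := fun h => hb (Fin.ext h.symm)
        simp [this]
      · simp
    · rw [Finset.sum_eq_zero]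
      · simp [shiftExtend, h]
      · intro b _
        have : (i : ℕ) + 1 ≠ b := by omega
        simp [this]

theorem sum_second_difference_ge (X : ℕ → ℝ) (m : ℕ) :
    (X m ^ 2 - X 0 ^ 2 + X 1 ^ 2 - X (m + 1) ^ 2) / 2 ≤
      ∑ n ∈ range m, X (n + 1) * (2 * X (n + 1) - X n - X (n + 2)) := by
  induction m with
  | zero => simp
  | succ m ih =>
    rw [Finset.sum_range_succ]
    nlinarith [sq_nonneg (X (m + 1) - X m), sq_nonneg (X (m + 1) - X (m + 2))]

theorem dotProduct_eq_sum_shiftExtend {N : ℕ} (x y : Fin N → ℝ) :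
    x ⬝ᵥ y = ∑ n ∈ range N, shiftExtend x (n + 1) * shiftExtend y (n + 1) := by
  rw [Finset.sum_range]
  simp only [shiftExtend_succ, dotProduct]

/-- The quadratic form of `Q_N` dominates that of its unbounded diagonal part. -/
theorem sum_sq_le_Qmat_form (α : ℝ) {N : ℕ} (x : Fin N → ℝ) :
    ∑ n ∈ range N, α * ((n : ℝ) + 1) ^ 2 * shiftExtend x (n + 1) ^ 2 ≤
      x ⬝ᵥ (Qmat α N *ᵥ x) := by
  have h0 : x ⬝ᵥ (Qmat α N *ᵥ x) = ∑ n ∈ range N, shiftExtend x (n + 1) *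
      ((α * ((n : ℝ) + 1) ^ 2 + 2) * shiftExtend x (n + 1)
        - shiftExtend x n - shiftExtend x (n + 2)) := by
    rw [Finset.sum_range, dotProduct]
    simp only [Qmat_mulVec_apply]
    simp only [shiftExtend_succ]
  have h1 := sum_second_difference_ge (shiftExtend x) N
  have h2 : shiftExtend x (N + 1) = 0 := by simp [shiftExtend]
  have h3 : shiftExtend x 0 = 0 := rfl
  rw [h2, h3] at h1
  have h4 : x ⬝ᵥ (Qmat α N *ᵥ x) =
      ∑ n ∈ range N, α * ((n : ℝ) + 1) ^ 2 * shiftExtend x (n + 1) ^ 2 +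
      ∑ n ∈ range N, shiftExtend x (n + 1) *
        (2 * shiftExtend x (n + 1) - shiftExtend x n - shiftExtend x (n + 2)) := by
    rw [h0, ← Finset.sum_add_distrib]
    exact Finset.sum_congr rfl fun n _ => by ring
  nlinarith [sq_nonneg (shiftExtend x N), sq_nonneg (shiftExtend x 1)]

theorem isEigSeq_diagonal {N : ℕ} {d : Fin N → ℝ} (hd : Monotone d) :
    IsEigSeq (Matrix.diagonal d) d := by
  refine ⟨hd, fun i => Pi.single i 1, fun i j => ?_, fun i => ?_⟩
  · simp [Pi.single_apply, eq_comm]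
  · ext j
    simp [Matrix.mulVec_diagonal, Pi.single_apply]
    split_ifs with h
    · rw [h]
    · rfl

theorem Qmat_eigenvalue_ge {α : ℝ} (hα : 0 < α) {N : ℕ} {μ : Fin N → ℝ}
    (hμ : IsEigSeq (Qmat α N) μ) (k : Fin N) : α * ((k : ℝ) + 1) ^ 2 ≤ μ k := by
  have hd : Monotone fun i : Fin N => α * ((i : ℕ) + 1 : ℝ) ^ 2 := by
    intro i j hij
    have : ((i : ℕ) : ℝ) ≤ ((j : ℕ) : ℝ) := by exact_mod_cast hij
    dsimp only
    gcongr
  refine hμ.le_of_form_le (isEigSeq_diagonal hd) LinearMap.id (fun _ => rfl) (fun x => ?_)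
    k k rfl
  refine le_trans (le_of_eq ?_) (sum_sq_le_Qmat_form α x)
  rw [Finset.sum_range]
  simp only [shiftExtend_succ, dotProduct, Matrix.mulVec_diagonal, LinearMap.id_apply]
  exact Finset.sum_congr rfl fun n _ => by ring

/-- Extension of a vector by a final zero. -/
def snocZero (N : ℕ) : (Fin N → ℝ) →ₗ[ℝ] (Fin (N + 1) → ℝ) where
  toFun x := Fin.snoc (α := fun _ => ℝ) x 0
  map_add' x y := by
    ext i
    refine Fin.lastCases ?_ (fun j => ?_) i <;> simp
  map_smul' c x := by
    ext i
    refine Fin.lastCases ?_ (fun j => ?_) i <;> simp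

@[simp] theorem snocZero_castSucc {N : ℕ} (x : Fin N → ℝ) (i : Fin N) :
    snocZero N x i.castSucc = x i := by
  simp [snocZero]

@[simp] theorem snocZero_last {N : ℕ} (x : Fin N → ℝ) :
    snocZero N x (Fin.last N) = 0 := by
  simp [snocZero]

theorem Qmat_eigenvalue_succ_le {α : ℝ} {N : ℕ} {μ : Fin N → ℝ} {ν : Fin (N + 1) → ℝ}
    (hμ : IsEigSeq (Qmat α N) μ) (hν : IsEigSeq (Qmat α (N + 1)) ν) (k : Fin N) :
    ν k.castSucc ≤ μ k := by
  refine hμ.le_of_form_le hν (snocZero N) (fun x => ?_) (fun x => le_of_eq ?_) k _ rfl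
  · simp [dotProduct, Fin.sum_univ_castSucc]
  · simp [dotProduct, Matrix.mulVec, Fin.sum_univ_castSucc, Qmat]

/-- The solution of the three-term recurrence with spectral parameter `t`. -/
def jacobiSol (α t : ℝ) : ℕ → ℝ
  | 0 => 0
  | 1 => 1
  | n + 2 => (α * ((n : ℝ) + 1) ^ 2 + 2 - t) * jacobiSol α t (n + 1) - jacobiSol α t n

theorem continuous_jacobiSol (α : ℝ) (n : ℕ) : Continuous fun t => jacobiSol α t n := by
  induction n using Nat.strong_induction_on with
  | _ n ih =>
    match n, ih with
    | 0, _ => simpa [jacobiSol] using continuous_const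
    | 1, _ => simpa [jacobiSol] using continuous_const
    | n + 2, ih =>
      have h1 := ih (n + 1) (by omega)
      have h0 := ih n (by omega)
      simp only [jacobiSol]
      fun_prop

theorem shiftExtend_eq_jacobiSol {α t : ℝ} {N : ℕ} {x : Fin N → ℝ}
    (hx : Qmat α N *ᵥ x = t • x) (n : ℕ) (hn : n ≤ N + 1) :
    shiftExtend x n = shiftExtend x 1 * jacobiSol α t n := by
  induction n using Nat.strong_induction_on with
  | _ n ih =>
    match n, ih with
    | 0, _ => simp [jacobiSol, shiftExtend]
    | 1, _ => simp [jacobiSol]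
    | n + 2, ih =>
      have h1 := ih (n + 1) (by omega) (by omega)
      have h0 := ih n (by omega) (by omega)
      have hi : n < N := by omega
      have h := congrFun hx ⟨n, hi⟩
      rw [Qmat_mulVec_apply, Pi.smul_apply, smul_eq_mul, ← shiftExtend_succ x ⟨n, hi⟩] at h
      simp only at h
      simp only [jacobiSol]
      linear_combination (-1) * h + (α * ((n : ℝ) + 1) ^ 2 + 2 - t) * h1 - h0

/-- Unit eigenvectors with bounded eigenvalue carry most of their mass on a fixed initial block. -/
theorem sum_tail_sq_le {α t B : ℝ} (hα : 0 < α) {M N : ℕ} (hMN : M ≤ N)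
    (htB : t ≤ B) (hM : 0 < M) (hB : 4 * B ≤ α * (M : ℝ) ^ 2) {x : Fin N → ℝ}
    (hx : Qmat α N *ᵥ x = t • x) (hx1 : x ⬝ᵥ x = 1) :
    ∑ n ∈ Ico M N, shiftExtend x (n + 1) ^ 2 ≤ 1 / 4 := by
  have h1 := sum_sq_le_Qmat_form α x
  rw [hx, dotProduct_smul, hx1, smul_eq_mul, mul_one] at h1
  have h2 : α * (M : ℝ) ^ 2 * ∑ n ∈ Ico M N, shiftExtend x (n + 1) ^ 2 ≤
      ∑ n ∈ range N, α * ((n : ℝ) + 1) ^ 2 * shiftExtend x (n + 1) ^ 2 := by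
    rw [Finset.mul_sum, ← Finset.sum_range_add_sum_Ico _ hMN]
    refine le_add_of_nonneg_of_le (Finset.sum_nonneg fun n _ => by positivity) ?_
    refine Finset.sum_le_sum fun n hn => ?_
    have : (M : ℝ) ≤ (n : ℝ) + 1 := by
      have := (Finset.mem_Ico.mp hn).1
      exact_mod_cast this.trans (Nat.le_succ n)
    gcongr
  have hc : 0 < α * (M : ℝ) ^ 2 := by positivity
  refine le_of_mul_le_mul_left ?_ hc
  linarith

/-- Orthogonality of two eigenvectors forces the corresponding initial blocks of the recurrence
solutions to be quantitatively non-parallel. -/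
theorem nine_mul_sq_sum_jacobiSol_le {α s t B : ℝ} (hα : 0 < α) {M N : ℕ} (hMN : M ≤ N)
    (hM : 0 < M) (hB : 4 * B ≤ α * (M : ℝ) ^ 2) (hs : s ≤ B) (ht : t ≤ B) {x y : Fin N → ℝ}
    (hx : Qmat α N *ᵥ x = s • x) (hy : Qmat α N *ᵥ y = t • y)
    (hx1 : x ⬝ᵥ x = 1) (hy1 : y ⬝ᵥ y = 1) (hxy : x ⬝ᵥ y = 0) :
    9 * (∑ n ∈ range M, jacobiSol α s (n + 1) * jacobiSol α t (n + 1)) ^ 2 ≤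
      (∑ n ∈ range M, jacobiSol α s (n + 1) ^ 2) * ∑ n ∈ range M, jacobiSol α t (n + 1) ^ 2 := by
  have tx := sum_tail_sq_le hα hMN hs hM hB hx hx1
  have ty := sum_tail_sq_le hα hMN ht hM hB hy hy1
  have cs := Finset.sum_mul_sq_le_sq_mul_sq (Ico M N) (fun n => shiftExtend x (n + 1))
    (fun n => shiftExtend y (n + 1))
  have split : ∀ {u v : ℝ} {z w : Fin N → ℝ}, Qmat α N *ᵥ z = u • z → Qmat α N *ᵥ w = v • w →
      z ⬝ᵥ w = shiftExtend z 1 * shiftExtend w 1 *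
        ∑ n ∈ range M, jacobiSol α u (n + 1) * jacobiSol α v (n + 1) +
        ∑ n ∈ Ico M N, shiftExtend z (n + 1) * shiftExtend w (n + 1) := by
    intro u v z w hz hw
    rw [dotProduct_eq_sum_shiftExtend, ← Finset.sum_range_add_sum_Ico _ hMN, Finset.mul_sum]
    congr 1
    refine Finset.sum_congr rfl fun n hn => ?_
    have := Finset.mem_range.mp hn
    rw [shiftExtend_eq_jacobiSol hz (n + 1) (by omega),
      shiftExtend_eq_jacobiSol hw (n + 1) (by omega)]
    ring
  have ex := split hx hx
  have ey := split hy hy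
  have exy := split hx hy
  rw [hx1] at ex
  rw [hy1] at ey
  rw [hxy] at exy
  simp only [← sq] at ex ey
  set S := ∑ n ∈ range M, jacobiSol α s (n + 1) ^ 2
  set T := ∑ n ∈ range M, jacobiSol α t (n + 1) ^ 2
  set C := ∑ n ∈ range M, jacobiSol α s (n + 1) * jacobiSol α t (n + 1)
  set a := shiftExtend x 1
  set b := shiftExtend y 1
  have hty : 0 ≤ ∑ n ∈ Ico M N, shiftExtend y (n + 1) ^ 2 :=
    Finset.sum_nonneg fun _ _ => sq_nonneg _
  have hS : 3 / 4 ≤ a ^ 2 * S := by linarith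
  have hT : 3 / 4 ≤ b ^ 2 * T := by linarith
  have hC : (a * b * C) ^ 2 ≤ 1 / 16 := by
    have h1 : a * b * C = -∑ n ∈ Ico M N, shiftExtend x (n + 1) * shiftExtend y (n + 1) := by
      linarith
    rw [h1, neg_sq]
    nlinarith
  have ha : a ≠ 0 := by
    intro h
    rw [h] at hS
    norm_num at hS
  have hb : b ≠ 0 := by
    intro h
    rw [h] at hT
    norm_num at hT
  have hab : 0 < a ^ 2 * b ^ 2 := by positivity
  refine le_of_mul_le_mul_left ?_ hab
  nlinarith [mul_le_mul hS hT (by norm_num) (by linarith)]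

/-- Fix `α > 0` and let `μ N` list the eigenvalues of `Q_N` in
nondecreasing order with multiplicity.  For each `k ≥ 1`, the sequence `N ↦ λ_k(Q_N)`
(defined for `N ≥ k`) is monotone nonincreasing, and the limit `λ_k = lim_N λ_k(Q_N)`
exists.  Moreover `λ_k < λ_{k+1}` for all `k ≥ 1`, and `λ_k ≥ α k²` for all `k ≥ 2`. -/
theorem statement12 (α : ℝ) (hα : 0 < α)
    (μ : (N : ℕ) → Fin N → ℝ) (hμ : ∀ N, IsEigSeq (Qmat α N) (μ N)) :
    (∀ k N : ℕ, 1 ≤ k → k ≤ N → eigAt μ k (N + 1) ≤ eigAt μ k N) ∧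
    ∃ lam : ℕ → ℝ,
      (∀ k : ℕ, 1 ≤ k → Tendsto (fun N => eigAt μ k N) atTop (nhds (lam k))) ∧
      (∀ k : ℕ, 1 ≤ k → lam k < lam (k + 1)) ∧
      (∀ k : ℕ, 2 ≤ k → α * (k : ℝ) ^ 2 ≤ lam k) := by
  have hmono : ∀ k N : ℕ, 1 ≤ k → k ≤ N → eigAt μ k (N + 1) ≤ eigAt μ k N := by
    intro k N hk hkN
    have h1 : k - 1 < N := by omega
    have h2 : k - 1 < N + 1 := by omega
    simp only [eigAt, h1, h2, dif_pos]
    exact Qmat_eigenvalue_succ_le (hμ N) (hμ (N + 1)) ⟨k - 1, h1⟩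
  have hlow : ∀ k N : ℕ, 1 ≤ k → k ≤ N → α * (k : ℝ) ^ 2 ≤ eigAt μ k N := by
    intro k N hk hkN
    have h1 : k - 1 < N := by omega
    have h := Qmat_eigenvalue_ge hα (hμ N) ⟨k - 1, h1⟩
    simpa [eigAt, h1, Nat.cast_sub hk] using h
  have hlim : ∀ k : ℕ, ∃ l : ℝ, 1 ≤ k → Tendsto (fun N => eigAt μ k N) atTop (nhds l) := by
    intro k
    by_cases hk : 1 ≤ k
    · have hanti : Antitone fun N => eigAt μ k (N + k) := by
        refine antitone_nat_of_succ_le fun N => ?_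
        have := hmono k (N + k) hk (by omega)
        rwa [show N + k + 1 = N + 1 + k by omega] at this
      have hbdd : BddBelow (Set.range fun N => eigAt μ k (N + k)) :=
        ⟨α * (k : ℝ) ^ 2, by rintro _ ⟨N, rfl⟩; exact hlow k (N + k) hk (by omega)⟩
      exact ⟨_, fun _ => (tendsto_add_atTop_iff_nat k).mp (tendsto_atTop_ciInf hanti hbdd)⟩
    · exact ⟨0, fun h => absurd h hk⟩
  choose lam hlam using hlim
  refine ⟨hmono, lam, hlam, fun k hk => ?_, fun k hk => ?_⟩
  · have hl1 := hlam k hk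
    have hl2 := hlam (k + 1) (by omega)
    have hle : ∀ N, k + 1 ≤ N → eigAt μ k N ≤ eigAt μ (k + 1) N := by
      intro N hN
      have h1 : k - 1 < N := by omega
      have h2 : k + 1 - 1 < N := by omega
      simp only [eigAt, h1, h2, dif_pos]
      exact (hμ N).1 (by simp [Fin.le_def])
    refine lt_of_le_of_ne (le_of_tendsto_of_tendsto hl1 hl2
      ((eventually_ge_atTop (k + 1)).mono hle)) fun heq => ?_
    rw [← heq] at hl2
    set l := lam k
    obtain ⟨m, hm⟩ := exists_nat_ge (4 * (l + 1) / α)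
    have hB : 4 * (l + 1) ≤ α * ((m + 1 : ℕ) : ℝ) ^ 2 := by
      rw [div_le_iff₀ hα] at hm
      have : (m : ℝ) ≤ ((m + 1 : ℕ) : ℝ) ^ 2 := by
        push_cast
        nlinarith [Nat.cast_nonneg (α := ℝ) m]
      nlinarith
    have hev : ∀ᶠ N in atTop,
        9 * (∑ n ∈ range (m + 1), jacobiSol α (eigAt μ k N) (n + 1) *
          jacobiSol α (eigAt μ (k + 1) N) (n + 1)) ^ 2 ≤
        (∑ n ∈ range (m + 1), jacobiSol α (eigAt μ k N) (n + 1) ^ 2) *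
          ∑ n ∈ range (m + 1), jacobiSol α (eigAt μ (k + 1) N) (n + 1) ^ 2 := by
      filter_upwards [eventually_ge_atTop (m + 1), eventually_ge_atTop (k + 1),
        hl1.eventually_le_const (lt_add_one l), hl2.eventually_le_const (lt_add_one l)]
        with N hN1 hN2 hs ht
      obtain ⟨-, v, hv, hQ⟩ := hμ N
      have h1 : k - 1 < N := by omega
      have h2 : k + 1 - 1 < N := by omega
      refine nine_mul_sq_sum_jacobiSol_le hα hN1 m.succ_pos hB hs ht
        (x := v ⟨k - 1, h1⟩) (y := v ⟨k + 1 - 1, h2⟩) ?_ ?_ ?_ ?_ ?_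
      · simpa only [eigAt, h1, dif_pos] using hQ ⟨k - 1, h1⟩
      · simpa only [eigAt, h2, dif_pos] using hQ ⟨k + 1 - 1, h2⟩
      · exact (hv _ _).trans (if_pos rfl)
      · exact (hv _ _).trans (if_pos rfl)
      · refine (hv _ _).trans (if_neg fun h => ?_)
        have := congrArg Fin.val h
        simp only at this
        omega
    have c1 : ∀ n, Tendsto (fun N => jacobiSol α (eigAt μ k N) n) atTop
        (nhds (jacobiSol α l n)) := fun n => ((continuous_jacobiSol α n).tendsto l).comp hl1
    have c2 : ∀ n, Tendsto (fun N => jacobiSol α (eigAt μ (k + 1) N) n) atTop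
        (nhds (jacobiSol α l n)) := fun n => ((continuous_jacobiSol α n).tendsto l).comp hl2
    have hfin := le_of_tendsto_of_tendsto
      (((tendsto_finsetSum (range (m + 1)) fun n _ =>
        (c1 (n + 1)).mul (c2 (n + 1))).pow 2).const_mul 9)
      ((tendsto_finsetSum (range (m + 1)) fun n _ => (c1 (n + 1)).pow 2).mul
        (tendsto_finsetSum (range (m + 1)) fun n _ => (c2 (n + 1)).pow 2)) hev
    simp only [← sq] at hfin
    have hpos : 1 ≤ ∑ n ∈ range (m + 1), jacobiSol α l (n + 1) ^ 2 := by
      have := Finset.single_le_sum (f := fun n => jacobiSol α l (n + 1) ^ 2)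
        (fun n _ => sq_nonneg _) (Finset.mem_range.mpr m.succ_pos)
      simpa [jacobiSol] using this
    nlinarith
  · exact ge_of_tendsto (hlam k (by omega))
      ((eventually_ge_atTop k).mono fun N hN => hlow k N (by omega) hN)
end

section
/- Fix α > 0 and let λ, μ ∈ ℝ. Suppose u: {0,1,2,…} → ℝ is square-summable, not identically zero, and satisfies the even recurrence: 2u_0 − √2 u_1 = λ u_0; −√2 u_0 + (α+2) u_1 − u_2 = λ u_1; and (α n² + 2) u_n − u_{n−1} − u_{n+1} = λ u_n for all n ≥ 2. Suppose v: ℕ → ℝ is square-summable, not identically zero, and satisfies the odd recurrence (α n² + 2) v_n − v_{n−1} − v_{n+1} = μ v_n for all n ≥ 1 (with v_0 = 0). Then λ ≠ μ; that is, the spectra of the even Jacobi operator B_α^ℰ and the odd Jacobi operator B_α^𝒪 are disjoint. -/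
/-- A sequence satisfying a second-order recurrence `f (n + 2) = c n * f (n + 1) - f n` with zero
initial values vanishes. -/
theorem eq_zero_of_three_term_recurrence {c f : ℕ → ℝ}
    (hf : ∀ n, f (n + 2) = c n * f (n + 1) - f n) (h0 : f 0 = 0) (h1 : f 1 = 0) (n : ℕ) :
    f n = 0 := by
  have h : f n = 0 ∧ f (n + 1) = 0 := by
    induction n with
    | zero => exact ⟨h0, h1⟩
    | succ k ih => exact ⟨ih.2, by rw [hf k, ih.1, ih.2]; ring⟩
  exact h.1

/-- The terms of a square-summable real sequence tend to zero. -/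
theorem tendsto_zero_of_summable_sq {f : ℕ → ℝ} (hf : Summable fun n => f n ^ 2) :
    Filter.Tendsto f Filter.atTop (nhds 0) := by
  have h := (Real.continuous_sqrt.tendsto 0).comp hf.tendsto_atTop_zero
  rw [Real.sqrt_zero] at h
  refine (tendsto_zero_iff_abs_tendsto_zero f).2 (h.congr fun n => ?_)
  exact Real.sqrt_sq_eq_abs (f n)

/-- The Wronskian of two solutions, tending to zero, of the same recurrence
`f (n + 2) = c n * f (n + 1) - f n` vanishes. -/
theorem wronskian_eq_zero_of_tendsto_zero {c f g : ℕ → ℝ}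
    (hf : ∀ n, f (n + 2) = c n * f (n + 1) - f n)
    (hg : ∀ n, g (n + 2) = c n * g (n + 1) - g n)
    (hf0 : Filter.Tendsto f Filter.atTop (nhds 0))
    (hg0 : Filter.Tendsto g Filter.atTop (nhds 0)) :
    f 0 * g 1 - f 1 * g 0 = 0 := by
  have hconst : ∀ n, f n * g (n + 1) - f (n + 1) * g n = f 0 * g 1 - f 1 * g 0 := by
    intro n
    induction n with
    | zero => rfl
    | succ k ih =>
      rw [← ih, hf k, hg k]
      ring
  have hlim : Filter.Tendsto (fun n => f n * g (n + 1) - f (n + 1) * g n)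
      Filter.atTop (nhds (0 * 0 - 0 * 0)) :=
    (hf0.mul ((Filter.tendsto_add_atTop_iff_nat 1).2 hg0)).sub
      (((Filter.tendsto_add_atTop_iff_nat 1).2 hf0).mul hg0)
  simp only [hconst, mul_zero, sub_zero] at hlim
  exact tendsto_nhds_unique tendsto_const_nhds hlim

/-- the even and odd spectra are disjoint.  Fix `α > 0` and `λ, μ ∈ ℝ`.
Suppose `u : ℕ → ℝ` is square-summable, not identically zero, and satisfies the eigenvalue
equation of the even Jacobi operator `B_α^ℰ`:
`2 u₀ - √2 u₁ = λ u₀`, `-√2 u₀ + (α+2) u₁ - u₂ = λ u₁`, and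
`(α n² + 2) uₙ - u_{n-1} - u_{n+1} = λ uₙ` for `n ≥ 2`.  Suppose `v : ℕ → ℝ` is
square-summable, not identically zero, has `v 0 = 0`, and satisfies the eigenvalue equation
of the odd Jacobi operator `B_α^𝒪`: `(α n² + 2) vₙ - v_{n-1} - v_{n+1} = μ vₙ` for `n ≥ 1`.
Then `λ ≠ μ`. -/
theorem statement14 (α : ℝ) (hα : 0 < α) (lam mu : ℝ) (u v : ℕ → ℝ)
    (hu2 : Summable fun n => u n ^ 2) (hune : u ≠ 0)
    (hu0 : 2 * u 0 - Real.sqrt 2 * u 1 = lam * u 0)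
    (hu1 : -Real.sqrt 2 * u 0 + (α + 2) * u 1 - u 2 = lam * u 1)
    (hun : ∀ n : ℕ, 2 ≤ n →
      (α * (n : ℝ) ^ 2 + 2) * u n - u (n - 1) - u (n + 1) = lam * u n)
    (hv2 : Summable fun n => v n ^ 2) (hvne : v ≠ 0) (hv0 : v 0 = 0)
    (hvn : ∀ n : ℕ, 1 ≤ n →
      (α * (n : ℝ) ^ 2 + 2) * v n - v (n - 1) - v (n + 1) = mu * v n) :
    lam ≠ mu := by
  rintro rfl
  have hs : Real.sqrt 2 ≠ 0 := by positivity
  have hu (n : ℕ) : u (n + 1 + 2) =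
      (α * ((n + 2 : ℕ) : ℝ) ^ 2 + 2 - lam) * u (n + 1 + 1) - u (n + 1) := by
    have h := hun (n + 2) (by omega)
    rw [show n + 2 - 1 = n + 1 by omega] at h
    linear_combination -h
  have hv (n : ℕ) : v (n + 2) =
      (α * ((n + 1 : ℕ) : ℝ) ^ 2 + 2 - lam) * v (n + 1) - v n := by
    have h := hvn (n + 1) (by omega)
    rw [show n + 1 - 1 = n by omega] at h
    linear_combination -h
  have hv1 : v 1 ≠ 0 := fun h =>
    hvne (funext (eq_zero_of_three_term_recurrence hv hv0 h))
  have hW : u 1 * v 2 - u 2 * v 1 = 0 :=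
    wronskian_eq_zero_of_tendsto_zero (f := fun n => u (n + 1)) (g := fun n => v (n + 1))
      hu (fun n => hv (n + 1))
      ((Filter.tendsto_add_atTop_iff_nat 1).2 (tendsto_zero_of_summable_sq hu2))
      ((Filter.tendsto_add_atTop_iff_nat 1).2 (tendsto_zero_of_summable_sq hv2))
  have hv2' : v 2 = (α + 2 - lam) * v 1 := by
    have h := hv 0
    simp only [zero_add, Nat.cast_one, hv0] at h
    linear_combination h
  have hu0' : u 0 = 0 := by
    have h : Real.sqrt 2 * v 1 * u 0 = 0 := by
      linear_combination hW - u 1 * hv2' - v 1 * hu1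
    exact (mul_eq_zero.1 h).resolve_left (mul_ne_zero hs hv1)
  have hu1' : u 1 = 0 := by
    have h : Real.sqrt 2 * u 1 = 0 := by
      linear_combination (2 - lam) * hu0' - hu0
    exact (mul_eq_zero.1 h).resolve_left hs
  have hu2' : u 2 = 0 := by
    linear_combination (α + 2 - lam) * hu1' - Real.sqrt 2 * hu0' - hu1
  refine hune (funext fun n => ?_)
  cases n with
  | zero => exact hu0'
  | succ k =>
    exact eq_zero_of_three_term_recurrence (f := fun n => u (n + 1)) hu hu1' hu2' k
end

section
/- Fix α > 0 and N ≥ 3. Let v ∈ ℝ^N be a unit vector with Q_N v = λ v for some λ < α(N−1)² + 2. Then the last entry of v satisfies |v_N| ≤ 2 / ((α N² + 2 − λ)(α (N−1)² + 2 − λ)). -/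
/-- The last row of `Q_N v`. -/
lemma Qmat_mulVec_last (α : ℝ) (n : ℕ) (v : Fin (n + 3) → ℝ) :
    (Qmat α (n + 3)).mulVec v ⟨n + 2, by omega⟩ =
      (α * ((n : ℝ) + 3) ^ 2 + 2) * v ⟨n + 2, by omega⟩ - v ⟨n + 1, by omega⟩ := by
  have h (x : Fin n) : ¬ n + 2 = (x : ℕ) ∧ ¬ n + 2 + 1 = (x : ℕ) ∧ ¬ (x : ℕ) + 1 = n + 2 := by
    omega
  simp only [Matrix.mulVec, dotProduct, Fin.sum_univ_castSucc, Qmat, Fin.val_castSucc, Fin.val_last,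
    h, or_self, if_false, zero_mul, Finset.sum_const_zero]
  norm_num [show n + 3 ≠ n by omega, Fin.last, Fin.castSucc, Fin.castAdd, Fin.castLE]
  ring

/-- The second to last row of `Q_N v`. -/
lemma Qmat_mulVec_penultimate (α : ℝ) (n : ℕ) (v : Fin (n + 3) → ℝ) :
    (Qmat α (n + 3)).mulVec v ⟨n + 1, by omega⟩ =
      (α * ((n : ℝ) + 2) ^ 2 + 2) * v ⟨n + 1, by omega⟩ - v ⟨n, by omega⟩
        - v ⟨n + 2, by omega⟩ := by
  have h (x : Fin n) : ¬ n + 1 = (x : ℕ) ∧ ¬ n + 1 + 1 = (x : ℕ) ∧ ¬ (x : ℕ) + 1 = n + 1 := by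
    omega
  simp only [Matrix.mulVec, dotProduct, Fin.sum_univ_castSucc, Qmat, Fin.val_castSucc, Fin.val_last,
    h, or_self, if_false, zero_mul, Finset.sum_const_zero]
  norm_num [Fin.last, Fin.castSucc, Fin.castAdd, Fin.castLE]
  ring

/-- decay of the last entry of eigenvectors of `Q_N`.  Fix `α > 0` and
`N ≥ 3`.  If `v ∈ ℝ^N` is a unit vector with `Q_N v = λ v` and `λ < α (N-1)² + 2`, then
`|v_N| ≤ 2 / ((α N² + 2 - λ)(α (N-1)² + 2 - λ))`. -/
theorem statement15 (α : ℝ) (hα : 0 < α) (N : ℕ) (hN : 3 ≤ N)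
    (lam : ℝ) (hlam : lam < α * ((N : ℝ) - 1) ^ 2 + 2)
    (v : Fin N → ℝ) (hunit : ∑ i, v i ^ 2 = 1)
    (hv : (Qmat α N).mulVec v = lam • v) :
    |v ⟨N - 1, by omega⟩| ≤
      2 / ((α * (N : ℝ) ^ 2 + 2 - lam) * (α * ((N : ℝ) - 1) ^ 2 + 2 - lam)) := by
  obtain ⟨n, rfl⟩ : ∃ n, N = n + 3 := ⟨N - 3, by omega⟩
  have hentry (i : Fin (n + 3)) : |v i| ≤ 1 := by
    rw [← sq_le_one_iff_abs_le_one, ← hunit]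
    exact Finset.single_le_sum (fun j _ => sq_nonneg (v j)) (Finset.mem_univ i)
  have hlast := congrFun hv ⟨n + 2, by omega⟩
  have hpen := congrFun hv ⟨n + 1, by omega⟩
  rw [Qmat_mulVec_last, Pi.smul_apply, smul_eq_mul] at hlast
  rw [Qmat_mulVec_penultimate, Pi.smul_apply, smul_eq_mul] at hpen
  change |v ⟨n + 2, _⟩| ≤ _
  push_cast at hlam ⊢
  rw [show (n : ℝ) + 3 - 1 = n + 2 by ring] at hlam ⊢
  have hd : 0 < α * ((n : ℝ) + 2) ^ 2 + 2 - lam := by linarith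
  have hD : 0 < α * ((n : ℝ) + 3) ^ 2 + 2 - lam := by
    have : α * ((n : ℝ) + 2) ^ 2 ≤ α * ((n : ℝ) + 3) ^ 2 := by gcongr; norm_num
    linarith
  have hpos := mul_pos hD hd
  rw [le_div_iff₀ hpos, ← abs_of_pos hpos, ← abs_mul]
  calc _ = |v ⟨n, by omega⟩ + v ⟨n + 2, by omega⟩| := by
        congr 1
        linear_combination (α * ((n : ℝ) + 2) ^ 2 + 2 - lam) * hlast + hpen
    _ ≤ |v ⟨n, by omega⟩| + |v ⟨n + 2, by omega⟩| := abs_add_le _ _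
    _ ≤ 2 := by linarith [hentry ⟨n, by omega⟩, hentry ⟨n + 2, by omega⟩]
end

section
/- Fix α > 0 and N ≥ 1. Let w ∈ ℝ^N satisfy Q_N w = λ w, let v ∈ ℝ^{N+1} satisfy Q_{N+1} v = μ v with μ ≠ λ, and let w̃ ∈ ℝ^{N+1} denote w extended by a final zero coordinate. Then ⟨v, w̃⟩ = −(w_N · v_{N+1}) / (μ − λ). In particular, if ‖v‖ = 1 and |μ − λ| ≥ δ > 0, then |⟨v, w̃⟩| ≤ |w_N| / δ. -/
/-- A vector of `ℝ^N` extended to `ℝ^{N+1}` by a final zero coordinate. -/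
def padOne {N : ℕ} (w : Fin N → ℝ) : Fin (N + 1) → ℝ := fun i =>
  if h : (i : ℕ) < N then w ⟨i, h⟩ else 0

/-- The leading principal `N × N` block of `Q_{N+1}` is `Q_N`. -/
lemma Qmat_castSucc_castSucc (α : ℝ) (N : ℕ) (i j : Fin N) :
    Qmat α (N + 1) i.castSucc j.castSucc = Qmat α N i j := rfl

lemma Qmat_comm (α : ℝ) (N : ℕ) (i j : Fin N) : Qmat α N i j = Qmat α N j i := by
  by_cases h : i = j
  · rw [h]
  · have h₁ : (i : ℕ) ≠ j := fun e => h (Fin.ext e)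
    simp only [Qmat, if_neg h₁, if_neg h₁.symm, or_comm]

/-- The border column of `Q_{N+1}` paired with `w` gives minus the last coordinate of `w`. -/
lemma sum_Qmat_castSucc_last_mul (α : ℝ) (n : ℕ) (w : Fin (n + 1) → ℝ) :
    ∑ i : Fin (n + 1), Qmat α (n + 1 + 1) i.castSucc (Fin.last (n + 1)) * w i
      = -w (Fin.last n) := by
  rw [Finset.sum_eq_single (Fin.last n)]
  · simp [Qmat]
  · intro i _ hi
    have h : (i : ℕ) ≠ n := fun e => hi (Fin.ext e)
    have h₁ : (i : ℕ) < n + 1 := i.isLt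
    have h₂ : ¬ (i : ℕ) = n + 1 := by omega
    have h₃ : ¬ ((i : ℕ) + 1 = n + 1 ∨ n + 1 + 1 = (i : ℕ)) := by omega
    simp only [Qmat, Fin.val_castSucc, Fin.val_last, if_neg h₂, if_neg h₃, zero_mul]
  · simp

lemma sum_mul_padOne {N : ℕ} (v : Fin (N + 1) → ℝ) (w : Fin N → ℝ) :
    ∑ i, v i * padOne w i = ∑ i : Fin N, v i.castSucc * w i := by
  simp [Fin.sum_univ_castSucc, padOne]

/-- Pairing the two eigenvalue equations leaves only the border term. -/
lemma sub_mul_sum_mul_padOne (α : ℝ) (n : ℕ) (lam mu : ℝ)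
    (w : Fin (n + 1) → ℝ) (hw : (Qmat α (n + 1)).mulVec w = lam • w)
    (v : Fin (n + 1 + 1) → ℝ) (hv : (Qmat α (n + 1 + 1)).mulVec v = mu • v) :
    (mu - lam) * ∑ i, v i * padOne w i = -(w (Fin.last n) * v (Fin.last (n + 1))) := by
  have hw' (j : Fin (n + 1)) : ∑ i, Qmat α (n + 1) j i * w i = lam * w j := congrFun hw j
  have hv' (i : Fin (n + 1)) :
      ∑ j : Fin (n + 1), Qmat α (n + 1) i j * v j.castSucc
        + Qmat α (n + 1 + 1) i.castSucc (Fin.last (n + 1)) * v (Fin.last (n + 1))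
        = mu * v i.castSucc := by
    have h := congrFun hv i.castSucc
    simpa only [Matrix.mulVec, dotProduct, Fin.sum_univ_castSucc (n := n + 1),
      Qmat_castSucc_castSucc, Pi.smul_apply, smul_eq_mul] using h
  have hsymm : ∑ i : Fin (n + 1), (∑ j : Fin (n + 1), Qmat α (n + 1) i j * v j.castSucc) * w i
      = lam * ∑ j : Fin (n + 1), v j.castSucc * w j := by
    simp_rw [Finset.sum_mul]
    rw [Finset.sum_comm, Finset.mul_sum]
    refine Finset.sum_congr rfl fun j _ => ?_
    rw [mul_left_comm, ← hw' j, Finset.mul_sum]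
    refine Finset.sum_congr rfl fun i _ => ?_
    rw [Qmat_comm α (n + 1) i j]
    ring
  have hborder : ∑ i : Fin (n + 1),
      Qmat α (n + 1 + 1) i.castSucc (Fin.last (n + 1)) * v (Fin.last (n + 1)) * w i
      = -(w (Fin.last n) * v (Fin.last (n + 1))) := by
    simp_rw [mul_right_comm _ (v (Fin.last (n + 1)))]
    rw [← Finset.sum_mul, sum_Qmat_castSucc_last_mul, neg_mul]
  have hsum : mu * ∑ i : Fin (n + 1), v i.castSucc * w i
      = lam * ∑ j : Fin (n + 1), v j.castSucc * w j
        + -(w (Fin.last n) * v (Fin.last (n + 1))) := by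
    rw [← hsymm, ← hborder, ← Finset.sum_add_distrib, Finset.mul_sum]
    refine Finset.sum_congr rfl fun i _ => ?_
    rw [← add_mul, hv' i, mul_assoc]
  rw [sum_mul_padOne]
  linarith

/-- inner product of eigenvectors across consecutive truncations.  Fix
`α > 0` and `N ≥ 1`.  Let `Q_N w = λ w`, `Q_{N+1} v = μ v` with `μ ≠ λ`, and let `w̃` be `w`
extended by a final zero.  Then `⟨v, w̃⟩ = -(w_N v_{N+1}) / (μ - λ)`; and if `‖v‖ = 1` and
`|μ - λ| ≥ δ > 0`, then `|⟨v, w̃⟩| ≤ |w_N| / δ`. -/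
theorem statement16 (α : ℝ) (hα : 0 < α) (N : ℕ) (hN : 1 ≤ N)
    (lam mu : ℝ) (hne : mu ≠ lam)
    (w : Fin N → ℝ) (hw : (Qmat α N).mulVec w = lam • w)
    (v : Fin (N + 1) → ℝ) (hv : (Qmat α (N + 1)).mulVec v = mu • v) :
    (∑ i, v i * padOne w i)
        = -(w ⟨N - 1, by omega⟩ * v (Fin.last N)) / (mu - lam) ∧
    ∀ δ : ℝ, 0 < δ → (∑ i, v i ^ 2) = 1 → δ ≤ |mu - lam| →
      |∑ i, v i * padOne w i| ≤ |w ⟨N - 1, by omega⟩| / δ := by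
  obtain ⟨n, rfl⟩ : ∃ n, N = n + 1 := ⟨N - 1, by omega⟩
  have hlast : (⟨n + 1 - 1, by omega⟩ : Fin (n + 1)) = Fin.last n := rfl
  have hsub : mu - lam ≠ 0 := sub_ne_zero.mpr hne
  have key : ∑ i, v i * padOne w i
      = -(w (Fin.last n) * v (Fin.last (n + 1))) / (mu - lam) := by
    rw [eq_div_iff hsub, mul_comm]
    exact sub_mul_sum_mul_padOne α n lam mu w hw v hv
  rw [hlast]
  refine ⟨key, fun δ hδ hnorm hgap => ?_⟩
  have hv_last : |v (Fin.last (n + 1))| ≤ 1 := by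
    rw [← sq_le_one_iff_abs_le_one, ← hnorm]
    exact Finset.single_le_sum (f := fun i => v i ^ 2) (fun i _ => sq_nonneg (v i))
      (Finset.mem_univ _)
  rw [key, abs_div, abs_neg, abs_mul]
  exact div_le_div₀ (abs_nonneg _) (mul_le_of_le_one_right (abs_nonneg _) hv_last) hδ hgap
end
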